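/- Let G be a finite abelian group of order n, where n has a prime divisor congruent to 2 mod 3, and let p be the smallest such prime. If A ⊆ G has |A| = (p+1)n/(3p) and 3A ≠ G, then |3A| = n − n/p. -/

import Mathlib

open Finset Pointwise

section Kneser

variable {G : Type*} [AddCommGroup G]

lemma card_le_card_of_forall_add_mem {H : AddSubgroup G} {x : G} {C : Finset G}
    (h : ∀ k ∈ H, x + k ∈ C) : Nat.card H ≤ #C := by
  rw [← Nat.card_eq_finsetCard]
  refine Nat.card_le_card_of_injective (fun k : H ↦ (⟨x + k, h k k.2⟩ : C)) fun a b hab ↦ ?_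
  simpa using hab

variable [DecidableEq G]

open AddAction in
lemma le_stabilizer_finset_iff {H : AddSubgroup G} {C : Finset G} :
    H ≤ stabilizer G C ↔ ∀ h ∈ H, ∀ c ∈ C, h + c ∈ C := by
  refine forall₂_congr fun h _ ↦ ?_
  rw [mem_stabilizer_finset']
  rfl

lemma stabilizer_le_stabilizer_add_left (A B : Finset G) :
    AddAction.stabilizer G A ≤ AddAction.stabilizer G (A + B) := by
  rw [le_stabilizer_finset_iff]
  intro h hh c hc
  obtain ⟨a, ha, b, hb, rfl⟩ := mem_add.1 hc
  rw [← add_assoc]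
  exact add_mem_add (AddAction.mem_stabilizer_finset'.1 hh ha) hb

lemma AddSubgroup.card_dvd_card_of_le_stabilizer {H : AddSubgroup G} {C : Finset G}
    (h : H ≤ AddAction.stabilizer G C) : Nat.card H ∣ #C := by
  rw [le_stabilizer_finset_iff] at h
  have hC : QuotientAddGroup.mk (s := H) ⁻¹' (QuotientAddGroup.mk (s := H) '' (C : Set G)) = C := by
    ext x
    constructor
    · rintro ⟨c, hc, hcx⟩
      have := h _ (QuotientAddGroup.eq.1 hcx) c hc
      simpa using this
    · intro hx
      exact ⟨x, hx, rfl⟩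
  have := Nat.card_congr (QuotientAddGroup.preimageMkEquivAddSubgroupProdSet H
    (QuotientAddGroup.mk (s := H) '' (C : Set G)))
  rw [hC, Nat.card_prod] at this
  exact ⟨_, (Nat.card_eq_finsetCard C).symm.trans this⟩

/-- Sums of elements of `P ⊆ H₁` and `Q ⊆ H₂` cover each point at most `#(H₁ ∩ H₂)` times. -/
lemma card_mul_card_le_card_inf_mul_card [Finite G] {H₁ H₂ : AddSubgroup G} {P Q D : Finset G} {x : G}
    (hP : ∀ h ∈ P, h ∈ H₁) (hQ : ∀ h ∈ Q, h ∈ H₂) (hD : ∀ h ∈ P, ∀ k ∈ Q, x + h + k ∈ D) :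
    #P * #Q ≤ Nat.card (H₁ ⊓ H₂ : AddSubgroup G) * #D := by
  rw [← card_product]
  refine card_le_mul_card_image_of_maps_to (f := fun u ↦ x + u.1 + u.2) ?_ _ ?_
  · simp only [mem_product]
    exact fun u hu ↦ hD _ hu.1 _ hu.2
  · intro d _
    set F := (P ×ˢ Q).filter fun u ↦ x + u.1 + u.2 = d with hF
    obtain hF0 | ⟨v, hv⟩ := F.eq_empty_or_nonempty
    · simp [hF0]
    have hmem : ∀ u ∈ F, u.1 - v.1 ∈ H₁ ⊓ H₂ := by
      intro u hu
      simp only [hF, mem_filter, mem_product] at hu hv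
      refine ⟨H₁.sub_mem (hP _ hu.1.1) (hP _ hv.1.1), ?_⟩
      have : u.1 - v.1 = v.2 - u.2 := by
        have := hu.2.trans hv.2.symm
        rw [sub_eq_sub_iff_add_eq_add]
        rw [add_assoc, add_assoc] at this
        rw [add_left_cancel this, add_comm]
      rw [this]
      exact H₂.sub_mem (hQ _ hv.1.2) (hQ _ hu.1.2)
    rw [← Nat.card_eq_finsetCard]
    refine Nat.card_le_card_of_injective
      (fun u : F ↦ (⟨u.1.1 - v.1, hmem u u.2⟩ : (H₁ ⊓ H₂ : AddSubgroup G))) ?_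
    rintro ⟨a, ha⟩ ⟨b, hb⟩ hab
    have h1 : a.1 = b.1 := by simpa using hab
    simp only [hF, mem_filter] at ha hb
    have h2 := ha.2.trans hb.2.symm
    rw [h1] at h2
    exact Subtype.ext (Prod.ext h1 (add_left_cancel h2))

/-- In a grid with `p + p'` rows and `q + q'` columns of weight `n`, complementary boxes cannot both
be small. -/
lemma add_le_or_add_le_of_mul_le_mul {n p p' q q' d d' : ℕ} (hn : 0 < n) (hp : n ≤ p) (hp' : n ≤ p')
    (hq : n ≤ q) (hq' : n ≤ q') (hd : p * q ≤ n * d) (hd' : p' * q' ≤ n * d') :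
    p + p' ≤ d + n ∨ q + q' ≤ d' + n := by
  have key : ∀ {a b e : ℕ}, n ≤ a → n ≤ b → a * b ≤ n * e → a + b ≤ e + n := by
    intro a b e ha hb he
    obtain ⟨a, rfl⟩ := Nat.exists_eq_add_of_le ha
    obtain ⟨b, rfl⟩ := Nat.exists_eq_add_of_le hb
    refine Nat.le_of_mul_le_mul_left ?_ hn
    nlinarith [Nat.zero_le (a * b)]
  have h1 := key hp hq hd
  have h2 := key hp' hq' hd'
  omega

/-- If `x` lies in `C₂ \ C₁`, one of the differences is large. -/
lemma card_sdiff_of_mem_sdiff [Finite G] {H₁ H₂ : AddSubgroup G} {C₁ C₂ : Finset G}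
    (h₁ : H₁ ≤ AddAction.stabilizer G C₁) (h₂ : H₂ ≤ AddAction.stabilizer G C₂)
    {x : G} (hx : x ∈ C₂ \ C₁) :
    Nat.card H₁ ≤ #(C₂ \ C₁) + Nat.card (H₁ ⊓ H₂ : AddSubgroup G) ∨
    Nat.card H₂ ≤ #(C₁ \ C₂) + Nat.card (H₁ ⊓ H₂ : AddSubgroup G) ∨
    Nat.card H₂ ≤ #(C₂ \ C₁) := by
  classical
  have := Fintype.ofFinite G
  have s₁ : ∀ h ∈ H₁, ∀ c, h + c ∈ C₁ ↔ c ∈ C₁ :=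
    fun h hh ↦ AddAction.mem_stabilizer_finset.1 (h₁ hh)
  have s₂ : ∀ h ∈ H₂, ∀ c, h + c ∈ C₂ ↔ c ∈ C₂ :=
    fun h hh ↦ AddAction.mem_stabilizer_finset.1 (h₂ hh)
  rw [mem_sdiff] at hx
  have row : ∀ h ∈ H₁, ∀ k ∈ H₂, x + h + k ∈ C₁ ↔ x + k ∈ C₁ := fun h hh k _ ↦ by
    rw [← s₁ h hh (x + k)]; abel_nf
  have col : ∀ h ∈ H₁, ∀ k ∈ H₂, x + h + k ∈ C₂ ↔ x + h ∈ C₂ := fun h _ k hk ↦ by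
    rw [← s₂ k hk (x + h)]; abel_nf
  have row0 : ∀ h ∈ H₁, x + h ∉ C₁ := fun h hh ↦ by
    rw [add_comm, s₁ h hh]; exact hx.2
  have col0 : ∀ k ∈ H₂, x + k ∈ C₂ := fun k hk ↦ by
    rw [add_comm, s₂ k hk]; exact hx.1
  by_cases hP : ∀ h ∈ H₁, x + h ∈ C₂
  · exact .inl <| (card_le_card_of_forall_add_mem (x := x) fun h hh ↦
      mem_sdiff.2 ⟨hP h hh, row0 h hh⟩).trans (Nat.le_add_right _ _)
  by_cases hQ : ∀ k ∈ H₂, x + k ∉ C₁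
  · exact .inr <| .inr <| card_le_card_of_forall_add_mem (x := x) fun k hk ↦
      mem_sdiff.2 ⟨col0 k hk, hQ k hk⟩
  push Not at hP hQ
  obtain ⟨h, hh, hhx⟩ := hP
  obtain ⟨k, hk, hkx⟩ := hQ
  set P := univ.filter fun g ↦ g ∈ H₁ ∧ x + g ∈ C₂ with hPdef
  set P' := univ.filter fun g ↦ g ∈ H₁ ∧ x + g ∉ C₂ with hPdef'
  set Q := univ.filter fun g ↦ g ∈ H₂ ∧ x + g ∉ C₁ with hQdef
  set Q' := univ.filter fun g ↦ g ∈ H₂ ∧ x + g ∈ C₁ with hQdef'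
  have cardsum : ∀ (H : AddSubgroup G) (p : G → Prop), Nat.card H =
      #(univ.filter fun g ↦ g ∈ H ∧ p g) + #(univ.filter fun g ↦ g ∈ H ∧ ¬ p g) := by
    intro H p
    rw [← filter_filter, ← filter_filter, card_filter_add_card_filter_not,
      Nat.card_eq_fintype_card, Fintype.card_subtype]
  have cP : Nat.card H₁ = #P + #P' := by
    convert cardsum H₁ fun g ↦ x + g ∈ C₂
  have cQ : Nat.card H₂ = #Q + #Q' := by
    rw [add_comm]; convert cardsum H₂ fun g ↦ x + g ∈ C₁
  have hPn : Nat.card (H₁ ⊓ H₂ : AddSubgroup G) ≤ #P :=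
    card_le_card_of_forall_add_mem (x := 0) fun g hg ↦ by
      simpa [hPdef] using ⟨hg.1, col0 g hg.2⟩
  have hQn : Nat.card (H₁ ⊓ H₂ : AddSubgroup G) ≤ #Q :=
    card_le_card_of_forall_add_mem (x := 0) fun g hg ↦ by
      simpa [hQdef] using ⟨hg.2, row0 g hg.1⟩
  have hPn' : Nat.card (H₁ ⊓ H₂ : AddSubgroup G) ≤ #P' :=
    card_le_card_of_forall_add_mem (x := h) fun g hg ↦ by
      simpa [hPdef', H₁.add_mem hh hg.1, ← add_assoc, col h hh g hg.2] using hhx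
  have hQn' : Nat.card (H₁ ⊓ H₂ : AddSubgroup G) ≤ #Q' :=
    card_le_card_of_forall_add_mem (x := k) fun g hg ↦ by
      rw [add_comm k g]
      simpa [hQdef', H₂.add_mem hg.2 hk, ← add_assoc, row g hg.1 k hk] using hkx
  have hd : #P * #Q ≤ Nat.card (H₁ ⊓ H₂ : AddSubgroup G) * #(C₂ \ C₁) := by
    refine card_mul_card_le_card_inf_mul_card (x := x) (by simp +contextual [hPdef])
      (by simp +contextual [hQdef]) fun g hg l hl ↦ ?_
    simp only [hPdef, hQdef, mem_filter, mem_univ, true_and] at hg hl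
    rw [mem_sdiff, col g hg.1 l hl.1, row g hg.1 l hl.1]
    exact ⟨hg.2, hl.2⟩
  have hd' : #P' * #Q' ≤ Nat.card (H₁ ⊓ H₂ : AddSubgroup G) * #(C₁ \ C₂) := by
    refine card_mul_card_le_card_inf_mul_card (x := x) (by simp +contextual [hPdef'])
      (by simp +contextual [hQdef']) fun g hg l hl ↦ ?_
    simp only [hPdef', hQdef', mem_filter, mem_univ, true_and] at hg hl
    rw [mem_sdiff, col g hg.1 l hl.1, row g hg.1 l hl.1]
    exact ⟨hl.2, hg.2⟩
  have := add_le_or_add_le_of_mul_le_mul Nat.card_pos hPn hPn' hQn hQn' hd hd'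
  omega

/-- **Kneser's lemma** on the union of two periodic sets. -/
lemma exists_le_stabilizer_union [Finite G] {H₁ H₂ : AddSubgroup G} {C₁ C₂ : Finset G} {N : ℕ}
    (h₁ : H₁ ≤ AddAction.stabilizer G C₁) (h₂ : H₂ ≤ AddAction.stabilizer G C₂)
    (hN₁ : N ≤ #C₁ + Nat.card H₁) (hN₂ : N ≤ #C₂ + Nat.card H₂) :
    ∃ H ≤ AddAction.stabilizer G (C₁ ∪ C₂), N ≤ #(C₁ ∪ C₂) + Nat.card H := by
  obtain h21 | ⟨x, hx⟩ := (C₂ \ C₁).eq_empty_or_nonempty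
  · rw [union_eq_left.2 (sdiff_eq_empty_iff_subset.1 h21)]
    exact ⟨H₁, h₁, hN₁⟩
  obtain h12 | ⟨y, hy⟩ := (C₁ \ C₂).eq_empty_or_nonempty
  · rw [union_eq_right.2 (sdiff_eq_empty_iff_subset.1 h12)]
    exact ⟨H₂, h₂, hN₂⟩
  refine ⟨H₁ ⊓ H₂, ?_, ?_⟩
  · rw [le_stabilizer_finset_iff] at *
    intro g hg c hc
    rw [mem_union] at *
    exact hc.imp (h₁ g hg.1 c) (h₂ g hg.2 c)
  · have a := card_sdiff_of_mem_sdiff h₁ h₂ hx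
    have b := card_sdiff_of_mem_sdiff h₂ h₁ hy
    rw [inf_comm H₂ H₁] at b
    have e₁ := card_sdiff_add_card C₁ C₂
    have e₂ := card_sdiff_add_card C₂ C₁
    rw [union_comm C₂ C₁] at e₂
    omega

/-- Iterated Dyson transforms produce a large periodic subset of `A + B` through a given point. -/
lemma exists_le_stabilizer_subset_add [Finite G] {A B : Finset G} {a b : G} (ha : a ∈ A)
    (hb : b ∈ B) : ∃ C ⊆ A + B, a + b ∈ C ∧ ∃ H ≤ AddAction.stabilizer G C,
      #A + #B ≤ #C + Nat.card H := by
  induction hn : #B using Nat.strong_induction_on generalizing A B with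
  | _ n ih =>
  subst hn
  by_cases hall : ∀ e ∈ A, ∀ y ∈ B, e - b + y ∈ A
  · have hB : ∀ y ∈ B, y - b ∈ AddAction.stabilizer G A := fun y hy ↦ by
      rw [AddAction.mem_stabilizer_finset']
      intro e he
      rw [vadd_eq_add, sub_add_eq_add_sub, add_comm, ← sub_add_eq_add_sub] at *
      exact hall e he y hy
    refine ⟨b +ᵥ A, ?_, ?_, AddAction.stabilizer G A, ?_, ?_⟩
    · intro z hz
      obtain ⟨e, he, rfl⟩ := mem_vadd_finset.1 hz
      rw [vadd_eq_add, add_comm b]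
      exact add_mem_add he hb
    · rw [add_comm a]
      exact vadd_mem_vadd_finset ha
    · rw [le_stabilizer_finset_iff]
      intro h hh c hc
      obtain ⟨e, he, rfl⟩ := mem_vadd_finset.1 hc
      rw [vadd_eq_add, add_left_comm]
      exact vadd_mem_vadd_finset (AddAction.mem_stabilizer_finset'.1 hh he)
    · rw [card_vadd_finset]
      gcongr
      rw [← Nat.card_eq_finsetCard]
      refine Nat.card_le_card_of_injective
        (fun y : B ↦ (⟨y - b, hB y y.2⟩ : AddAction.stabilizer G A)) fun u v huv ↦ ?_
      exact Subtype.ext (sub_left_injective (congrArg Subtype.val huv))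
  · push Not at hall
    obtain ⟨e, he, y, hy, hey⟩ := hall
    set A' := A ∪ ((e - b) +ᵥ B) with hA'
    set B' := B ∩ (-(e - b) +ᵥ A) with hB'
    have hmemB' : ∀ z, z ∈ B' ↔ z ∈ B ∧ e - b + z ∈ A := fun z ↦ by
      rw [hB', mem_inter, mem_neg_vadd_finset_iff, vadd_eq_add]
    have hcard : #A' + #B' = #A + #B := by
      have : #B' = #(A ∩ ((e - b) +ᵥ B)) := by
        rw [← card_vadd_finset (e - b) B', hB', vadd_finset_inter, vadd_neg_vadd, inter_comm]
      rw [this, hA', card_union_add_card_inter, card_vadd_finset]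
    have hlt : #B' < #B := card_lt_card <| (ssubset_iff_of_subset inter_subset_left).2
      ⟨y, hy, fun h ↦ hey ((hmemB' y).1 h).2⟩
    obtain ⟨C, hC, hab, H, hH, hle⟩ := ih _ hlt (A := A') (B := B')
      (mem_union_left _ ha) ((hmemB' b).2 ⟨hb, by simpa using he⟩) rfl
    refine ⟨C, hC.trans fun z hz ↦ ?_, hab, H, hH, hcard ▸ hle⟩
    obtain ⟨u, hu, v, hv, rfl⟩ := mem_add.1 hz
    rw [hmemB'] at hv
    obtain hu | hu := mem_union.1 hu
    · exact add_mem_add hu hv.1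
    · obtain ⟨w, hw, rfl⟩ := mem_vadd_finset.1 hu
      rw [vadd_eq_add, add_right_comm]
      exact add_mem_add hv.2 hw

/-- A weak form of **Kneser's theorem**. -/
lemma card_add_card_le_card_add_add_card_stabilizer [Finite G] {A B : Finset G}
    (hA : A.Nonempty) (hB : B.Nonempty) :
    #A + #B ≤ #(A + B) + Nat.card (AddAction.stabilizer G (A + B)) := by
  have key : ∀ T : Finset G, T.Nonempty → T ⊆ A + B → ∃ C ⊆ A + B, T ⊆ C ∧
      ∃ H ≤ AddAction.stabilizer G C, #A + #B ≤ #C + Nat.card H := by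
    intro T hT
    induction hT using Finset.Nonempty.cons_induction with
    | singleton z =>
      intro hz
      obtain ⟨a, ha, b, hb, rfl⟩ := mem_add.1 (hz (mem_singleton_self z))
      obtain ⟨C, hC, hab, hH⟩ := exists_le_stabilizer_subset_add ha hb
      exact ⟨C, hC, singleton_subset_iff.2 hab, hH⟩
    | cons z T hzT hT ih =>
      intro hz
      rw [cons_eq_insert, insert_subset_iff] at hz
      obtain ⟨C₁, hC₁, hTC, H₁, hH₁, hle₁⟩ := ih hz.2
      obtain ⟨a, ha, b, hb, rfl⟩ := mem_add.1 hz.1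
      obtain ⟨C₂, hC₂, hab, H₂, hH₂, hle₂⟩ := exists_le_stabilizer_subset_add ha hb
      refine ⟨C₁ ∪ C₂, union_subset hC₁ hC₂, ?_, exists_le_stabilizer_union hH₁ hH₂ hle₁ hle₂⟩
      rw [cons_eq_insert, insert_subset_iff]
      exact ⟨mem_union_right _ hab, hTC.trans subset_union_left⟩
  obtain ⟨C, hC, hC', H, hH, hle⟩ := key (A + B) (hA.add hB) subset_rfl
  obtain rfl := hC.antisymm hC'
  exact hle.trans (Nat.add_le_add_left (AddSubgroup.card_le_of_le hH) _)

/-- The periodic hull of `A` with respect to the stabilizer of `A + A + A` obeys the bound given by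
Kneser's theorem for three summands. -/
lemma exists_superset_three_mul_card_le [Finite G] {A : Finset G} (hA : A.Nonempty) :
    ∃ B, A ⊆ B ∧ AddAction.stabilizer G (A + A + A) ≤ AddAction.stabilizer G B ∧
      3 * #B ≤ #(A + A + A) + 2 * Nat.card (AddAction.stabilizer G (A + A + A)) := by
  classical
  have := Fintype.ofFinite G
  set S := AddAction.stabilizer G (A + A + A) with hS
  set F : Finset G := univ.filter (· ∈ S) with hF
  have hsub : A ⊆ A + F := fun a ha ↦ by
    rw [← add_zero a]
    exact add_mem_add ha (by simp [hF, S.zero_mem])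
  have hBBB : A + F + (A + F) + (A + F) = A + A + A := by
    refine Subset.antisymm (fun z hz ↦ ?_) (add_subset_add (add_subset_add hsub hsub) hsub)
    simp only [mem_add, hF, mem_filter, mem_univ, true_and] at hz
    obtain ⟨_, ⟨_, ⟨a, ha, f, hf, rfl⟩, _, ⟨b, hb, g, hg, rfl⟩, rfl⟩, _, ⟨c, hc, h, hh, rfl⟩, rfl⟩ :=
      hz
    have := AddAction.mem_stabilizer_finset'.1 (S.add_mem (S.add_mem hf hg) hh)
      (add_mem_add (add_mem_add ha hb) hc)
    rw [vadd_eq_add] at this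
    convert this using 1
    abel
  have hne := hA.mono hsub
  refine ⟨A + F, hsub, ?_, ?_⟩
  · rw [le_stabilizer_finset_iff]
    intro h hh c hc
    obtain ⟨a, ha, f, hf, rfl⟩ := mem_add.1 hc
    rw [add_left_comm]
    refine add_mem_add ha ?_
    simp only [hF, mem_filter, mem_univ, true_and] at hf ⊢
    exact S.add_mem hh hf
  · have h1 := card_add_card_le_card_add_add_card_stabilizer hne hne
    have h2 := card_add_card_le_card_add_add_card_stabilizer (hne.add hne) hne
    have h3 := AddSubgroup.card_le_of_le
      (stabilizer_le_stabilizer_add_left (A + F + (A + F)) (A + F))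
    rw [hBBB, ← hS] at h2 h3
    omega

end Kneser

lemma Nat.exists_prime_dvd_mod_three_eq_two {m : ℕ} (hm : m % 3 = 2) :
    ∃ q, q.Prime ∧ q ∣ m ∧ q % 3 = 2 := by
  induction m using Nat.strong_induction_on with
  | _ m ih =>
  have hm1 : m ≠ 1 := by omega
  obtain ⟨k, hk⟩ := m.minFac_dvd
  have hprime := Nat.minFac_prime hm1
  set r := m.minFac
  by_cases hr : r % 3 = 2
  · exact ⟨r, hprime, ⟨k, hk⟩, hr⟩
  have hmod : r % 3 * (k % 3) % 3 = 2 := by rw [← Nat.mul_mod, ← hk, hm]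
  have hk2 : k % 3 = 2 := by
    have h1 : r % 3 < 3 := Nat.mod_lt _ (by norm_num)
    have h2 : k % 3 < 3 := Nat.mod_lt _ (by norm_num)
    interval_cases r % 3 <;> interval_cases k % 3 <;> omega
  have hkm : k < m := by
    rw [hk]
    exact (Nat.lt_mul_iff_one_lt_left (by omega)).2 hprime.one_lt
  obtain ⟨q, hq, hqk, hq2⟩ := ih k hkm hk2
  exact ⟨q, hq, hqk.trans ⟨r, by rw [hk, mul_comm]⟩, hq2⟩

theorem stmt_15 {G : Type*} [AddCommGroup G] [Fintype G] [DecidableEq G]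
    (p : ℕ) (hp : p.Prime) (hpn : p ∣ Fintype.card G) (hp2 : p % 3 = 2)
    (hmin : ∀ q : ℕ, q.Prime → q ∣ Fintype.card G → q % 3 = 2 → p ≤ q)
    (A : Finset G) (hA : A.card = (p + 1) * Fintype.card G / (3 * p))
    (hinc : A + A + A ≠ Finset.univ) :
    (A + A + A).card = Fintype.card G - Fintype.card G / p := by
  have hp0 := hp.pos
  have hA3 : 3 * p * #A = (p + 1) * Fintype.card G := by
    rw [hA]
    exact Nat.mul_div_cancel' (mul_dvd_mul (by omega) hpn)
  have hne : A.Nonempty := by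
    rw [← card_pos]
    refine Nat.pos_of_mul_pos_left (a := 3 * p) ?_
    rw [hA3]
    exact Nat.mul_pos p.succ_pos Fintype.card_pos
  obtain ⟨B, hAB, hSB, hle⟩ := exists_superset_three_mul_card_le hne
  set S := AddAction.stabilizer G (A + A + A) with hS
  have hs : 0 < Nat.card S := Nat.card_pos
  have hub : #(A + A + A) + Nat.card S ≤ Fintype.card G := by
    obtain ⟨x, hx⟩ := not_forall.1 (mt eq_univ_iff_forall.2 hinc)
    have : Nat.card S ≤ #(A + A + A)ᶜ := card_le_card_of_forall_add_mem (x := x) fun k hk ↦ by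
      rw [mem_compl, add_comm x, ← vadd_eq_add k, AddAction.mem_stabilizer_finset.1 hk]
      exact hx
    have := card_add_card_compl (A + A + A)
    omega
  obtain ⟨k, hk⟩ := AddSubgroup.card_dvd_card_of_le_stabilizer hSB
  obtain ⟨m, hm⟩ := AddSubgroup.card_addSubgroup_dvd_card S
  rw [Nat.card_eq_fintype_card (α := G)] at hm
  have hABc := card_le_card hAB
  set s := Nat.card S
  have h3k : 3 * k ≤ m + 1 := by
    refine Nat.le_of_mul_le_mul_left ?_ hs
    nlinarith
  have hpk : (p + 1) * m ≤ 3 * p * k := by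
    refine Nat.le_of_mul_le_mul_left ?_ hs
    nlinarith
  have hm0 : 0 < m := by
    refine Nat.pos_of_mul_pos_left (a := s) ?_
    rw [← hm]
    exact Fintype.card_pos
  have hmk : m < 3 * k := by
    refine Nat.lt_of_mul_lt_mul_left (a := p) ?_
    nlinarith
  have hk3 : 3 * k = m + 1 := by omega
  have hmp : m ≤ p := by nlinarith
  obtain ⟨q, hq, hqm, hq2⟩ := Nat.exists_prime_dvd_mod_three_eq_two (m := m) (by omega)
  have hpq := hmin q hq (hm ▸ hqm.mul_left s) hq2
  obtain rfl : m = p := hmp.antisymm (hpq.trans (Nat.le_of_dvd hm0 hqm))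
  have hdiv : Fintype.card G / m = s := by rw [hm, Nat.mul_div_cancel _ hm0]
  rw [hdiv]
  have : 3 * #B = Fintype.card G + s := by
    rw [hk, hm]
    linear_combination s * hk3
  omega
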